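/- Let ℓ ≥ 2 be an integer and let A be an infinite set of nonnegative integers. If r_{A,2}(n) ≥ ℓ for all sufficiently large integers n in the sumset 2A, then there is a positive real number w₀ such that A(x) > (ℓ − 1)(log x)/(log 2) − w₀ for all real x ≥ 2. -/

import Mathlib

/-- The representation function `r_{A,h}(n)`: the number of nondecreasing
`h`-tuples `(a₁,…,a_h)` of elements of `A` with `a₁ + ⋯ + a_h = n`. -/
noncomputable def rep (A : Set ℕ) (h n : ℕ) : ℕ :=
  Set.ncard {f : Fin h → ℕ | (∀ i, f i ∈ A) ∧ Monotone f ∧ ∑ i, f i = n}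

/-- The `h`-fold sumset `hA`: all sums of `h` not necessarily distinct elements of `A`. -/
def sumset (A : Set ℕ) (h : ℕ) : Set ℕ :=
  {n | ∃ f : Fin h → ℕ, (∀ i, f i ∈ A) ∧ ∑ i, f i = n}

/-- The counting function `A(x)`: the number of `a ∈ A` with `1 ≤ a ≤ x`. -/
noncomputable def count (A : Set ℕ) (x : ℝ) : ℕ :=
  Set.ncard {a : ℕ | a ∈ A ∧ 1 ≤ a ∧ (a : ℝ) ≤ x}

/-- The representations of `2 * a` are determined by their larger part, which is `a` itself
or an element of `A` in `(a, 2 * a]`. -/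
theorem rep_two_mul_le (A : Set ℕ) (a : ℕ) :
    rep A 2 (2 * a) ≤ {b | b ∈ A ∧ a < b ∧ b ≤ 2 * a}.ncard + 1 := by
  have hfin : {b | b ∈ A ∧ a < b ∧ b ≤ 2 * a}.Finite :=
    (Set.finite_Iic (2 * a)).subset fun b hb => hb.2.2
  refine le_trans ?_ (Set.ncard_insert_le a _)
  refine Set.ncard_le_ncard_of_injOn (fun f => f 1) ?_ ?_ (hfin.insert a)
  · rintro f ⟨hf, hmono, hsum⟩
    have h01 : f 0 ≤ f 1 := hmono (by decide)
    rw [Fin.sum_univ_two] at hsum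
    rcases eq_or_ne (f 1) a with h | h
    · exact Or.inl h
    · exact Or.inr ⟨hf 1, by omega, by omega⟩
  · rintro f ⟨-, -, hf⟩ g ⟨-, -, hg⟩ h
    dsimp only at h
    rw [Fin.sum_univ_two] at hf hg
    funext i
    fin_cases i
    · show f 0 = g 0
      omega
    · exact h

theorem two_mul_mem_sumset {A : Set ℕ} {a : ℕ} (ha : a ∈ A) : 2 * a ∈ sumset A 2 :=
  ⟨fun _ => a, fun _ => ha, by simp⟩

theorem finite_setOf_count (A : Set ℕ) (x : ℝ) :
    {a : ℕ | a ∈ A ∧ 1 ≤ a ∧ (a : ℝ) ≤ x}.Finite :=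
  (Set.finite_Iic ⌊x⌋₊).subset fun _ ha => Nat.le_floor ha.2.2

theorem count_mono (A : Set ℕ) {x y : ℝ} (h : x ≤ y) : count A x ≤ count A y :=
  Set.ncard_le_ncard (fun _ ha => ⟨ha.1, ha.2.1, ha.2.2.trans h⟩) (finite_setOf_count A y)

/-- If `2 * a` has at least `ℓ ≥ 2` representations, then some `b ∈ A` in `(a, 2 * a]` is preceded
by at least `ℓ - 1` more elements of `A` than `a`. -/
theorem exists_count_add_le {ℓ : ℕ} (hℓ : 2 ≤ ℓ) {A : Set ℕ} {a : ℕ}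
    (hr : ℓ ≤ rep A 2 (2 * a)) :
    ∃ b ∈ A, a < b ∧ b ≤ 2 * a ∧ count A a + (ℓ - 1) ≤ count A b := by
  set S := {b | b ∈ A ∧ a < b ∧ b ≤ 2 * a} with hS
  have hfin : S.Finite := (Set.finite_Iic (2 * a)).subset fun b hb => hb.2.2
  have hcard : ℓ - 1 ≤ S.ncard := by
    have := hr.trans (rep_two_mul_le A a)
    rw [← hS] at this
    omega
  have hne : S.Nonempty := by
    rw [← Set.ncard_pos hfin]
    omega
  obtain ⟨b, hb, hmax⟩ := Set.exists_max_image S id hfin hne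
  refine ⟨b, hb.1, hb.2.1, hb.2.2, (Nat.add_le_add_left hcard _).trans ?_⟩
  unfold count
  rw [← Set.ncard_union_eq _ (finite_setOf_count A a) hfin]
  · refine Set.ncard_le_ncard ?_ (finite_setOf_count A b)
    rintro c (⟨hc, h1, hca⟩ | hc)
    · exact ⟨hc, h1, hca.trans (by exact_mod_cast hb.2.1.le)⟩
    · have hac := hc.2.1
      exact ⟨hc.1, by omega, by exact_mod_cast hmax c hc⟩
  · rw [Set.disjoint_left]
    rintro c ⟨-, -, hca⟩ hc
    exact absurd hc.2.1 (not_lt.mpr (by exact_mod_cast hca))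

theorem exists_mul_le_count {ℓ : ℕ} (hℓ : 2 ≤ ℓ) {A : Set ℕ} {a : ℕ} (ha : a ∈ A)
    (hr : ∀ b ∈ A, a ≤ b → ℓ ≤ rep A 2 (2 * b)) (k : ℕ) :
    ∃ b ∈ A, a ≤ b ∧ b ≤ 2 ^ k * a ∧ k * (ℓ - 1) ≤ count A b := by
  induction k with
  | zero => exact ⟨a, ha, le_rfl, by simp, by simp⟩
  | succ k ih =>
    obtain ⟨b, hb, hab, hbk, hcount⟩ := ih
    obtain ⟨c, hc, hbc, hcb, hcount'⟩ := exists_count_add_le hℓ (hr b hb hab)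
    refine ⟨c, hc, by omega, ?_, ?_⟩
    · rw [pow_succ]
      linarith
    · rw [add_mul, one_mul]
      omega

theorem stmt_1 (ℓ : ℕ) (hℓ : 2 ≤ ℓ) (A : Set ℕ) (hA : A.Infinite)
    (hr : ∃ n₀ : ℕ, ∀ n : ℕ, n₀ ≤ n → n ∈ sumset A 2 → ℓ ≤ rep A 2 n) :
    ∃ w₀ : ℝ, 0 < w₀ ∧ ∀ x : ℝ, (2 : ℝ) ≤ x →
      (count A x : ℝ) > ((ℓ : ℝ) - 1) * Real.log x / Real.log 2 - w₀ := by
  obtain ⟨n₀, hn₀⟩ := hr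
  obtain ⟨a, ha, han⟩ := hA.exists_gt n₀
  have hstep := exists_mul_le_count hℓ ha fun b hb hab =>
    hn₀ (2 * b) (by omega) (two_mul_mem_sumset hb)
  have ha1 : (1 : ℝ) ≤ a := by exact_mod_cast (show 1 ≤ a by omega)
  have hℓ1 : (0 : ℝ) < (ℓ : ℝ) - 1 := by
    have : (2 : ℝ) ≤ ℓ := by exact_mod_cast hℓ
    linarith
  have hloga : 0 ≤ Real.logb 2 a := Real.logb_nonneg one_lt_two ha1
  refine ⟨((ℓ : ℝ) - 1) * (Real.logb 2 a + 1), by positivity, fun x hx => ?_⟩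
  have hlog : ((ℓ : ℝ) - 1) * Real.log x / Real.log 2 = ((ℓ : ℝ) - 1) * Real.logb 2 x :=
    mul_div_assoc _ _ _
  have hdiv : Real.logb 2 (x / a) = Real.logb 2 x - Real.logb 2 a :=
    Real.logb_div (by linarith) (by linarith)
  rw [hlog, ← mul_sub, gt_iff_lt]
  rcases lt_or_ge x a with hxa | hxa
  · have : Real.logb 2 x < Real.logb 2 a :=
      Real.logb_lt_logb one_lt_two (by linarith) hxa
    exact (mul_neg_of_pos_of_neg hℓ1 (by linarith)).trans_le (Nat.cast_nonneg _)
  · set k := ⌊Real.logb 2 (x / a)⌋₊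
    have hxa1 : 1 ≤ x / a := (one_le_div (by linarith)).mpr hxa
    have hk1 : (k : ℝ) ≤ Real.logb 2 (x / a) :=
      Nat.floor_le (Real.logb_nonneg one_lt_two hxa1)
    have hk2 : Real.logb 2 (x / a) < k + 1 := Nat.lt_floor_add_one _
    obtain ⟨b, -, -, hbk, hcount⟩ := hstep k
    have hbx : (b : ℝ) ≤ x := by
      have h1 : (b : ℝ) ≤ 2 ^ k * a := by exact_mod_cast hbk
      rw [Real.le_logb_iff_rpow_le one_lt_two (by linarith), Real.rpow_natCast,
        le_div_iff₀ (by linarith)] at hk1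
      exact h1.trans hk1
    have hcx : ((k * (ℓ - 1) : ℕ) : ℝ) ≤ count A x := by
      exact_mod_cast hcount.trans (count_mono A hbx)
    rw [Nat.cast_mul, Nat.cast_sub (by omega), Nat.cast_one, mul_comm] at hcx
    exact (mul_lt_mul_of_pos_left (by linarith) hℓ1).trans_le hcx
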